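/- arXiv:1307.1989 — 8 statements merged into one kernel-verified Lean document; each statement's English description precedes it below -/
import Mathlib

section
/- A topological space X is compact if and only if every discrete subset of X has compact closure in X. (A subset D of X is discrete if every point of D has a neighborhood meeting D in only that point, i.e., D is discrete in its subspace topology.) -/
open Cardinal Set in
/-- A noncompact space has a rank function with open initial segments, unbounded. -/
theorem exists_rank.{u} {X : Type u} [TopologicalSpace X] (h : ¬ CompactSpace X) :
    ∃ (c : Cardinal.{u}) (r : X → c.ord.ToType), (∀ i, IsOpen {x | r x ≤ i}) ∧ ∀ i, ∃ x, i < r x := by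
  classical
  let P : Set (Set (Set X)) := {s | (∀ u ∈ s, IsOpen u) ∧ ⋃₀ s = Set.univ ∧
    ∀ t ⊆ s, t.Finite → ⋃₀ t ≠ Set.univ}
  have hP : P.Nonempty := by
    by_contra hne
    apply h
    refine ⟨isCompact_of_finite_subcover ?_⟩
    intro ι U hU hcov
    by_contra hfin
    apply hne
    refine ⟨range U, ?_, ?_, ?_⟩
    · rintro _ ⟨i, rfl⟩; exact hU i
    · rw [sUnion_range]; exact univ_subset_iff.1 hcov
    · intro t ht htf hcov'
      have : Nonempty ι := by
        by_contra hne'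
        apply h
        have : IsEmpty X := ⟨fun x => by
          obtain ⟨i, -⟩ := mem_iUnion.1 (hcov (mem_univ x))
          exact hne' ⟨i⟩⟩
        infer_instance
      have ht' : ∀ u : Set X, u ∈ t → ∃ i, U i = u := fun u hu => ht hu
      choose! g hg using ht'
      refine hfin ⟨htf.toFinset.image g, fun x _ => ?_⟩
      obtain ⟨u, hu, hx⟩ := mem_sUnion.1 (hcov' ▸ mem_univ x : x ∈ ⋃₀ t)
      refine mem_iUnion₂.2 ⟨g u, Finset.mem_image_of_mem g (htf.mem_toFinset.2 hu), ?_⟩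
      rw [hg u hu]
      exact hx
  obtain ⟨s, hs, hmin⟩ := (InvImage.wf (fun s : Set (Set X) => #s) Cardinal.lt_wf).has_min P hP
  obtain ⟨hso, hsc, hsf⟩ := hs
  have hinf : ℵ₀ ≤ #s := by
    by_contra hlt
    exact hsf s subset_rfl (lt_aleph0_iff_set_finite.1 (not_le.1 hlt)) hsc
  obtain ⟨e⟩ : Nonempty ((#s).ord.ToType ≃ s) := Cardinal.eq.1 (by simp)
  have hex : ∀ x : X, ∃ i, x ∈ (e i : Set X) := by
    intro x
    obtain ⟨u, hu, hx⟩ := mem_sUnion.1 (hsc ▸ mem_univ x : x ∈ ⋃₀ s)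
    exact ⟨e.symm ⟨u, hu⟩, by simpa using hx⟩
  have hwf : ∀ x : X, ∃ i, x ∈ (e i : Set X) ∧ ∀ j, x ∈ (e j : Set X) → i ≤ j := by
    intro x
    obtain ⟨i, hi, hm⟩ := (wellFounded_lt (α := (#s).ord.ToType)).has_min
      {i | x ∈ (e i : Set X)} (hex x)
    exact ⟨i, hi, fun j hj => not_lt.1 (hm j hj)⟩
  choose r hr hrm using hwf
  have hle : ∀ i, {x | r x ≤ i} = ⋃₀ ((fun j => (e j : Set X)) '' Iic i) := by
    intro i
    ext x
    simp only [mem_ofPred_eq, sUnion_image, mem_iUnion, mem_Iic, exists_prop]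
    exact ⟨fun hx => ⟨r x, hx, hr x⟩, fun ⟨j, hj, hx⟩ => (hrm x j hx).trans hj⟩
  refine ⟨#s, r, ?_, ?_⟩
  · intro i
    rw [hle]
    apply isOpen_sUnion
    rintro _ ⟨j, -, rfl⟩
    exact hso _ (e j).2
  · intro i
    by_contra! hi
    refine hmin ((fun j => (e j : Set X)) '' Iic i) ⟨?_, ?_, ?_⟩ ?_
    · rintro _ ⟨j, -, rfl⟩
      exact hso _ (e j).2
    · rw [← hle]; exact eq_univ_of_forall hi
    · intro t ht
      refine hsf t (ht.trans ?_)
      rintro _ ⟨j, -, rfl⟩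
      exact (e j).2
    · show #_ < #s
      refine mk_image_le.trans_lt ?_
      have := mk_Iic_lt i (by simp) (by simpa using hinf)
      simpa using this

/-- A topological space `X` is compact iff every discrete subset of `X`
has compact closure in `X`. -/
theorem stmt0 {X : Type*} [TopologicalSpace X] :
    CompactSpace X ↔ ∀ D : Set X, DiscreteTopology D → IsCompact (closure D) := by
  constructor
  · intro _ D _
    exact isClosed_closure.isCompact
  intro H
  by_contra hX
  obtain ⟨c, r, hopen, hunb⟩ := exists_rank hX
  let good : Set X → Prop := fun D =>
    Set.InjOn r D ∧ ∀ x ∈ D, x ∉ closure {y ∈ D | r y < r x}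
  let le : {D // good D} → {D // good D} → Prop := fun D E =>
    D.1 ⊆ E.1 ∧ ∀ y ∈ E.1, y ∉ D.1 → ∀ x ∈ D.1, r x < r y
  have hdisc : ∀ D, good D → DiscreteTopology D := by
    rintro D ⟨hinj, hcl⟩
    rw [discreteTopology_subtype_iff']
    intro x hx
    refine ⟨{z | r z ≤ r x} ∩ (closure {y ∈ D | r y < r x})ᶜ,
      (hopen _).inter isClosed_closure.isOpen_compl, ?_⟩
    ext y
    constructor
    · rintro ⟨⟨h1, h2⟩, hy⟩
      rcases lt_or_eq_of_le (show r y ≤ r x from h1) with h | h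
      · exact (h2 (subset_closure ⟨hy, h⟩)).elim
      · exact hinj hy hx h
    · rintro rfl
      exact ⟨⟨le_refl (r y), hcl y hx⟩, hx⟩
  obtain ⟨M, hM⟩ := exists_maximal_of_chains_bounded (r := le) (by
    intro C hC
    have key : ∀ D ∈ C, ∀ E ∈ C, le D E ∨ le E D := by
      intro D hD E hE
      by_cases h : D = E
      · subst h
        exact Or.inl ⟨subset_rfl, fun y hy hy' => (hy' hy).elim⟩
      · exact hC hD hE h
    have hend : ∀ D ∈ C, ∀ E ∈ C, ∀ y ∈ E.1, y ∉ D.1 → ∀ x ∈ D.1, r x < r y := by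
      intro D hD E hE y hy hy' x hx
      rcases key D hD E hE with h | h
      · exact h.2 y hy hy' x hx
      · exact (hy' (h.1 hy)).elim
    refine ⟨⟨{x | ∃ D ∈ C, x ∈ D.1}, ?_, ?_⟩, ?_⟩
    · rintro x ⟨D, hD, hx⟩ y ⟨E, hE, hy⟩ hxy
      rcases key D hD E hE with h | h
      · exact E.2.1 (h.1 hx) hy hxy
      · exact D.2.1 hx (h.1 hy) hxy
    · rintro x ⟨D, hD, hx⟩ hcl
      refine D.2.2 x hx (closure_mono ?_ hcl)
      rintro y ⟨⟨E, hE, hy⟩, hlt⟩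
      refine ⟨?_, hlt⟩
      by_contra hy'
      exact lt_asymm hlt (hend D hD E hE y hy hy' x hx)
    · intro D hD
      refine ⟨fun x hx => ⟨D, hD, hx⟩, ?_⟩
      rintro y ⟨E, hE, hy⟩ hy' x hx
      exact hend D hD E hE y hy hy' x hx)
    (by
      rintro A B C ⟨h1, h2⟩ ⟨h3, h4⟩
      refine ⟨h1.trans h3, fun y hy hy' x hx => ?_⟩
      by_cases hB : y ∈ B.1
      · exact h2 y hB hy' x hx
      · exact h4 y hy hB x (h1 hx))
  -- the closure of `M` lies in an initial segment
  have hcpt := H M.1 (hdisc M.1 M.2)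
  obtain ⟨x, hx⟩ : ∃ x, ∀ y ∈ closure M.1, r y < r x := by
    obtain ⟨t, ht⟩ := hcpt.elim_finite_subcover (fun i => {x | r x ≤ i}) hopen
      (fun y _ => Set.mem_iUnion.2 ⟨r y, le_refl (r y)⟩)
    have : Nonempty c.ord.ToType := by
      by_contra hne
      apply hX
      have : IsEmpty X := ⟨fun x => hne ⟨r x⟩⟩
      infer_instance
    obtain ⟨i, hi⟩ := t.exists_le
    obtain ⟨x, hx⟩ := hunb i
    refine ⟨x, fun y hy => ?_⟩
    obtain ⟨j, hj, hyj⟩ := Set.mem_iUnion₂.1 (ht hy)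
    exact lt_of_le_of_lt (le_trans hyj (hi j hj)) hx
  have hxM : x ∉ M.1 := fun h => lt_irrefl _ (hx x (subset_closure h))
  have hlt : ∀ y ∈ M.1, r y < r x := fun y hy => hx y (subset_closure hy)
  have hgood : good (insert x M.1) := by
    refine ⟨?_, ?_⟩
    · rw [Set.injOn_insert hxM]
      refine ⟨M.2.1, ?_⟩
      rintro ⟨y, hy, hxy⟩
      exact (hlt y hy).ne hxy
    · rintro z (rfl | hz) hcl
      · refine lt_irrefl _ (hx z (closure_mono ?_ hcl))
        rintro y ⟨rfl | hy, h⟩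
        · exact (lt_irrefl _ h).elim
        · exact hy
      · refine M.2.2 z hz (closure_mono ?_ hcl)
        rintro y ⟨rfl | hy, h⟩
        · exact (lt_asymm h (hlt z hz)).elim
        · exact ⟨hy, h⟩
  have := hM ⟨insert x M.1, hgood⟩ ⟨Set.subset_insert _ _, by
    rintro y (rfl | hy) hy' z hz
    · exact hlt z hz
    · exact (hy' hy).elim⟩
  exact hxM (this.1 (Set.mem_insert _ _))
end

section
/- Every non-isolated point of a compact Hausdorff space X is discretely touchable, i.e., for every point x of X that is not isolated there exists a discrete subset D of X such that x is an accumulation point of D (x lies in the closure of D ∖ {x}). -/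
theorem aux_chain.{u} {X : Type u} [TopologicalSpace X] [CompactSpace X] [T2Space X]
    (x : X) (hx : ¬ IsOpen ({x} : Set X)) :
    ∃ (ι : Type u) (_ : LinearOrder ι) (_ : WellFoundedLT ι) (_ : Nonempty ι) (F : ι → Set X),
      (∀ i, IsClosed (F i)) ∧ Antitone F ∧ (∀ i, ∃ y ∈ F i, y ≠ x) ∧
      (∀ y, y ≠ x → ∃ i, y ∉ F i) := by
  classical
  let P : Cardinal → Prop := fun c => ∃ S : Set (Set X), Cardinal.mk S = c ∧
    (∀ N ∈ S, IsClosed N ∧ N ∈ nhds x) ∧ ∀ y, y ≠ x → ∃ N ∈ S, y ∉ N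
  have hP : ∃ c, P c := by
    refine ⟨_, {N | IsClosed N ∧ N ∈ nhds x}, rfl, fun N h => h, fun y hy => ?_⟩
    have h1 : ({y}ᶜ : Set X) ∈ nhds x := isOpen_compl_singleton.mem_nhds (Ne.symm hy)
    obtain ⟨N, hN, hc, hs⟩ := exists_mem_nhds_isClosed_subset h1
    exact ⟨N, ⟨hc, hN⟩, fun h => hs h rfl⟩
  obtain ⟨c, ⟨S, hSc, hS, hSx⟩, hmin⟩ :=
    (Cardinal.lt_wf).has_min {c | P c} hP
  have hinf : Cardinal.aleph0 ≤ c := by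
    by_contra h
    push Not at h
    rw [← hSc, Cardinal.lt_aleph0_iff_set_finite] at h
    apply hx
    have h2 : ⋂₀ S ∈ nhds x := (Filter.sInter_mem h).2 fun N hN => (hS N hN).2
    have h3 : ⋂₀ S ⊆ {x} := by
      intro y hy
      by_contra hne
      obtain ⟨N, hN, hyN⟩ := hSx y hne
      exact hyN (hy N hN)
    rw [isOpen_singleton_iff_nhds_eq_pure]
    exact le_antisymm (Filter.le_pure_iff.2 (Filter.mem_of_superset h2 h3)) (pure_le_nhds x)
  have hcard : Cardinal.mk c.ord.ToType = Cardinal.mk S := by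
    rw [hSc]; simp
  obtain ⟨e⟩ := Cardinal.eq.1 hcard
  have hne : Nonempty c.ord.ToType := by
    rw [← Cardinal.mk_ne_zero_iff, hcard, hSc]
    exact (lt_of_lt_of_le Cardinal.aleph0_pos hinf).ne'
  refine ⟨c.ord.ToType, inferInstance, inferInstance, hne,
    fun i => ⋂ j ∈ Set.Iic i, (e j : Set X), ?_, ?_, ?_, ?_⟩
  · exact fun i => isClosed_biInter fun j _ => (hS _ (e j).2).1
  · intro i j hij
    exact Set.biInter_subset_biInter_left (Set.Iic_subset_Iic.2 hij)
  · intro i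
    by_contra hcon
    push Not at hcon
    refine hmin (Cardinal.mk ((fun j => (e j : Set X)) '' Set.Iic i)) ⟨_, rfl, ?_, ?_⟩ ?_
    · rintro _ ⟨j, _, rfl⟩
      exact hS _ (e j).2
    · intro y hy
      by_contra h
      push Not at h
      refine hy (hcon y ?_)
      simp only [Set.mem_iInter]
      exact fun j hj => h _ ⟨j, hj, rfl⟩
    · refine lt_of_le_of_lt Cardinal.mk_image_le ?_
      have h1 : Cardinal.mk (Set.Iio i) < c := Cardinal.mk_Iio_toType_ord_lt i
      rw [← Set.Iio_insert]
      refine lt_of_le_of_lt Cardinal.mk_insert_le ?_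
      exact Cardinal.add_lt_of_lt hinf h1 (lt_of_lt_of_le Cardinal.one_lt_aleph0 hinf)
  · intro y hy
    obtain ⟨N, hN, hyN⟩ := hSx y hy
    refine ⟨e.symm ⟨N, hN⟩, fun h => hyN ?_⟩
    simp only [Set.mem_iInter] at h
    simpa using h (e.symm ⟨N, hN⟩) (Set.mem_Iic.2 le_rfl)

/-- Every non-isolated point of a compact Hausdorff space is discretely touchable:
it is an accumulation point of a discrete subset. -/
theorem stmt1 {X : Type*} [TopologicalSpace X] [CompactSpace X] [T2Space X]
    (x : X) (hx : ¬ IsOpen ({x} : Set X)) :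
    ∃ D : Set X, DiscreteTopology D ∧ x ∈ closure (D \ {x}) := by
  classical
  obtain ⟨ι, _, _, _, F, hcl, hanti, hF, hFx⟩ := aux_chain x hx
  by_contra hcon
  push Not at hcon
  have hK : ∀ (K : Set X) (i : ι), IsClosed K → x ∉ K → ∃ d, i ≤ d ∧ ∀ y ∈ K, y ∉ F d := by
    intro K i hKc hxK
    obtain ⟨d, hd⟩ := hKc.isCompact.elim_directed_family_closed F hcl (by
      ext y
      simp only [Set.mem_inter_iff, Set.mem_iInter, Set.mem_empty_iff_false, iff_false, not_and]
      intro hy h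
      obtain ⟨j, hj⟩ := hFx y (fun h => hxK (h ▸ hy))
      exact hj (h j)) hanti.directed_ge
    refine ⟨max i d, le_max_left _ _, fun y hy h => ?_⟩
    have : y ∈ K ∩ F d := ⟨hy, hanti (le_max_right i d) h⟩
    rw [hd] at this
    exact this
  have hpick : ∀ (D : Set X) (i : ι), ∃ z : X, x ∉ closure D →
      z ≠ x ∧ ∃ d, i ≤ d ∧ (∀ y ∈ closure D, y ∉ F d) ∧ z ∈ F d := by
    intro D i
    by_cases h : x ∈ closure D
    · exact ⟨x, fun h' => absurd h h'⟩
    · obtain ⟨d, hid, hd⟩ := hK _ i isClosed_closure h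
      obtain ⟨z, hz, hzx⟩ := hF d
      exact ⟨z, fun _ => ⟨hzx, d, hid, hd, hz⟩⟩
  choose pick hp using hpick
  let f : ι → X := (wellFounded_lt (α := ι)).fix
    (fun i g => pick {z | ∃ j, ∃ h : j < i, g j h = z} i)
  have hf : ∀ i, f i = pick (f '' Set.Iio i) i := by
    intro i
    have h1 : f i = pick {z | ∃ j, ∃ h : j < i, f j = z} i := WellFounded.fix_eq _ _ i
    rw [h1]
    congr 1
    ext z
    simp
  let P : ι → Prop := fun i => f i ≠ x ∧ ∃ d, i ≤ d ∧
    (∀ y ∈ closure (f '' Set.Iio i), y ∉ F d) ∧ f i ∈ F d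
  have hdisc : ∀ I : Set ι, (∀ i ∈ I, P i) → x ∉ closure (f '' I) := by
    intro I hI
    have hD : DiscreteTopology (f '' I) := by
      rw [discreteTopology_subtype_iff']
      rintro _ ⟨b, hb, rfl⟩
      obtain ⟨hbx, d, hbd, hd, hfd⟩ := hI b hb
      obtain ⟨r, hr, hrmin⟩ := (wellFounded_lt (α := ι)).has_min {r | f b ∉ F r} (hFx _ hbx)
      refine ⟨(F r)ᶜ ∩ (closure (f '' Set.Iio b))ᶜ,
        (hcl r).isOpen_compl.inter isClosed_closure.isOpen_compl, ?_⟩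
      apply Set.Subset.antisymm
      · rintro _ ⟨⟨h1, h2⟩, a, ha, rfl⟩
        rcases lt_trichotomy a b with hab | rfl | hab
        · exact absurd (subset_closure (Set.mem_image_of_mem f (Set.mem_Iio.2 hab))) h2
        · rfl
        · obtain ⟨_, d', _, hd', hfd'⟩ := hI a ha
          have h3 : f b ∉ F d' := hd' _ (subset_closure ⟨b, hab, rfl⟩)
          exact absurd (hanti (not_lt.1 (hrmin d' h3)) hfd') h1
      · rintro _ rfl
        exact ⟨⟨hr, fun h => hd _ h hfd⟩, b, hb, rfl⟩
    have h := hcon _ hD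
    rwa [Set.sdiff_singleton_eq_self] at h
    rintro ⟨i, hi, hix⟩
    exact (hI i hi).1 hix
  have hPall : ∀ i, P i := by
    intro i
    induction i using (wellFounded_lt (α := ι)).induction with
    | _ i ih =>
      have h := hp (f '' Set.Iio i) i (hdisc _ fun j hj => ih j hj)
      rw [← hf] at h
      exact h
  have hx' := hdisc Set.univ fun i _ => hPall i
  obtain ⟨d, _, hd⟩ := hK _ (Classical.arbitrary ι) isClosed_closure hx'
  obtain ⟨_, d', hdd', _, h⟩ := hPall d
  exact hd (f d) (subset_closure ⟨d, trivial, rfl⟩) (hanti hdd' h)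
end

section
/- In every right separated topological space, the set of isolated points is dense. Consequently, if S is a right separated subspace of a topological space X and x ∈ X is an accumulation point of S (x ∈ closure(S ∖ {x})), then x is discretely touchable in X, i.e., x is an accumulation point of a discrete subset of X. -/
/-- A topological space is right separated if it admits a well-ordering in which
every initial segment is open. -/
def RightSeparatedSpace (Y : Type*) [TopologicalSpace Y] : Prop :=
  ∃ r : Y → Y → Prop, IsWellOrder Y r ∧ ∀ y : Y, IsOpen {z : Y | r z y}

theorem rightSep_dense (Y : Type*) [TopologicalSpace Y] (h : RightSeparatedSpace Y) :
    Dense {y : Y | IsOpen ({y} : Set Y)} := by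
  obtain ⟨r, hr, ho⟩ := h
  have wf : WellFounded r := hr.toIsWellFounded.wf
  have tri : ∀ a b, r a b ∨ a = b ∨ r b a := fun a b => trichotomous_of r a b
  rw [dense_iff_inter_open]
  intro U hU hne
  obtain ⟨y, hyU, hy⟩ := wf.has_min U hne
  refine ⟨y, hyU, ?_⟩
  show IsOpen ({y} : Set Y)
  by_cases hw : ({w | r y w} : Set Y).Nonempty
  · obtain ⟨w, hyw, hmin⟩ := wf.has_min _ hw
    have : ({y} : Set Y) = U ∩ {z | r z w} := by
      ext z
      constructor
      · rintro rfl
        exact ⟨hyU, hyw⟩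
      · rintro ⟨hz, hzw⟩
        rcases tri z y with h | h | h
        · exact absurd h (hy z hz)
        · exact h
        · exact absurd hzw (hmin z h)
    rw [this]
    exact hU.inter (ho w)
  · have : ({y} : Set Y) = U := by
      ext z
      constructor
      · rintro rfl
        exact hyU
      · intro hz
        rcases tri z y with h | h | h
        · exact absurd h (hy z hz)
        · exact h
        · exact absurd ⟨z, h⟩ hw
    rw [this]
    exact hU

/-- A subspace of a right separated space is right separated. -/
theorem rightSep_comap {A Y : Type*} [TopologicalSpace A] [TopologicalSpace Y]
    (f : A → Y) (hf : Continuous f) (hi : Function.Injective f)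
    (h : RightSeparatedSpace Y) : RightSeparatedSpace A := by
  obtain ⟨r, hr, ho⟩ := h
  let e : (f ⁻¹'o r) ↪r r := ⟨⟨f, hi⟩, Iff.rfl⟩
  exact ⟨f ⁻¹'o r, e.isWellOrder, fun a => (ho (f a)).preimage hf⟩

/-- In every right separated space the set of isolated points is dense; consequently,
any accumulation point of a right separated subspace is discretely touchable. -/
theorem stmt2 :
    (∀ (Y : Type u) [TopologicalSpace Y], RightSeparatedSpace Y →
      Dense {y : Y | IsOpen ({y} : Set Y)}) ∧
    (∀ (X : Type u) [TopologicalSpace X] (S : Set X) (x : X),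
      RightSeparatedSpace S → x ∈ closure (S \ {x}) →
      ∃ D : Set X, DiscreteTopology D ∧ x ∈ closure (D \ {x})) := by
  refine ⟨fun Y _ h => rightSep_dense Y h, ?_⟩
  intro X _ S x hS hx
  have hT : RightSeparatedSpace (S \ {x} : Set X) :=
    rightSep_comap (Set.inclusion Set.diff_subset) (continuous_inclusion Set.diff_subset)
      (Set.inclusion_injective Set.diff_subset) hS
  have hd := rightSep_dense _ hT
  refine ⟨Subtype.val '' {y : (S \ {x} : Set X) | IsOpen ({y} : Set (S \ {x} : Set X))}, ?_, ?_⟩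
  · rw [discreteTopology_subtype_iff']
    rintro _ ⟨y, hy, rfl⟩
    obtain ⟨V, hV, hVy⟩ := isOpen_induced_iff.1 hy
    refine ⟨V, hV, ?_⟩
    have key : ∀ z : (S \ {x} : Set X), z.1 ∈ V ↔ z = y := fun z => by
      have := Set.ext_iff.1 hVy z
      simpa using this
    ext z
    constructor
    · rintro ⟨hz, z, _, rfl⟩
      rw [(key z).1 hz]
      rfl
    · rintro rfl
      exact ⟨(key y).2 rfl, y, hy, rfl⟩
  · rw [mem_closure_iff] at hx ⊢
    intro V hV hxV
    obtain ⟨s, hsV, hs⟩ := hx V hV hxV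
    obtain ⟨y, hyV, hy⟩ := dense_iff_inter_open.1 hd (Subtype.val ⁻¹' V)
      (hV.preimage continuous_subtype_val) ⟨⟨s, hs⟩, hsV⟩
    exact ⟨y, hyV, ⟨y, hy, rfl⟩, y.2.2⟩
end

section
/- If p is a non-isolated point of a Hausdorff space X and χ(p,X) = ψ(p,X) ≥ ω (the character at p equals the pseudo-character at p, and this common value is infinite), then p is discretely touchable in X, i.e., p is an accumulation point of a discrete subset of X. -/
open Cardinal

/-- The character `χ(p,X)`: the smallest cardinality of a neighborhood base at `p`. -/
noncomputable def character {X : Type u} [TopologicalSpace X] (p : X) : Cardinal.{u} :=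
  sInf {c : Cardinal.{u} | ∃ B : Set (Set X), c = #B ∧
    (∀ U ∈ B, U ∈ nhds p) ∧ ∀ V ∈ nhds p, ∃ U ∈ B, U ⊆ V}

/-- The pseudo-character `ψ(p,X)`: the smallest cardinality of a family of open
sets whose intersection is `{p}`. -/
noncomputable def pseudoCharacter {X : Type u} [TopologicalSpace X] (p : X) : Cardinal.{u} :=
  sInf {c : Cardinal.{u} | ∃ B : Set (Set X), c = #B ∧
    (∀ U ∈ B, IsOpen U) ∧ ⋂₀ B = {p}}

/-- If `p` is a non-isolated point of a Hausdorff space `X` and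
`χ(p,X) = ψ(p,X) ≥ ω`, then `p` is discretely touchable in `X`. -/
theorem stmt5 {X : Type u} [TopologicalSpace X] [T2Space X]
    (p : X) (hp : ¬ IsOpen ({p} : Set X))
    (heq : character p = pseudoCharacter p) (hinf : Cardinal.aleph0 ≤ character p) :
    ∃ D : Set X, DiscreteTopology D ∧ p ∈ closure (D \ {p}) := by
  classical
  obtain ⟨B, hB, hBn, hBb⟩ : character p ∈ {c : Cardinal.{u} | ∃ B : Set (Set X), c = #B ∧
      (∀ U ∈ B, U ∈ nhds p) ∧ ∀ V ∈ nhds p, ∃ U ∈ B, U ⊆ V} := by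
    apply csInf_mem
    exact ⟨_, {U | U ∈ nhds p}, rfl, fun U h => h, fun V h => ⟨V, h, subset_rfl⟩⟩
  have key : ∀ C : Set (Set X), #C < character p → (∀ U ∈ C, IsOpen U ∧ p ∈ U) →
      ∃ y, y ≠ p ∧ ∀ U ∈ C, y ∈ U := by
    intro C hC hU
    by_contra! hcon
    rw [heq] at hC
    refine notMem_of_lt_csInf hC (OrderBot.bddBelow _) ⟨C, rfl, fun U h => (hU U h).1, ?_⟩
    ext y
    simp only [Set.mem_sInter, Set.mem_singleton_iff]
    constructor
    · intro h
      by_contra hy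
      obtain ⟨U, h1, h2⟩ := hcon y hy
      exact h2 (h U h1)
    · rintro rfl U h
      exact (hU U h).2
  have hW : ∀ x : X, ∃ W V : Set X, IsOpen W ∧ p ∈ W ∧
      (x ≠ p → IsOpen V ∧ x ∈ V ∧ Disjoint V W) := by
    intro x
    by_cases hx : x = p
    · exact ⟨Set.univ, Set.univ, isOpen_univ, trivial, fun h => (h hx).elim⟩
    · obtain ⟨V, W, h1, h2, h3, h4, h5⟩ := t2_separation hx
      exact ⟨W, V, h2, h4, fun _ => ⟨h1, h3, h5⟩⟩
  choose W V hWo hpW hV using hW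
  let ι := (character p).ord.ToType
  have hι : #ι = #B := by rw [← hB]; exact Cardinal.mk_ord_toType _
  obtain ⟨e⟩ := Cardinal.eq.1 hι
  let P : (i : ι) → ((j : ι) → j < i → X) → X → Prop := fun i f y =>
    y ≠ p ∧ y ∈ interior (e i : Set X) ∧ (∀ j h, y ∈ W (f j h)) ∧
      y ∉ closure {z | ∃ j h, f j h = z}
  let F : (i : ι) → ((j : ι) → j < i → X) → X := fun i f =>
    if h : ∃ y, P i f y then h.choose else p
  let x : ι → X := (wellFounded_lt (α := ι)).fix F
  have hx : ∀ i, x i = F i (fun j _ => x j) := fun i => WellFounded.fix_eq _ _ _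
  have good : ∀ i, p ∉ closure {z | ∃ j, ∃ _ : j < i, x j = z} → P i (fun j _ => x j) (x i) := by
    intro i hi
    have hex : ∃ y, P i (fun j _ => x j) y := by
      obtain ⟨y, hy, hyU⟩ := key
        (Set.range (fun j : Set.Iio i => W (x j)) ∪
          {interior (e i : Set X), (closure {z | ∃ j, ∃ _ : j < i, x j = z})ᶜ}) (by
          refine (Cardinal.mk_union_le _ _).trans_lt (Cardinal.add_lt_of_lt hinf ?_ ?_)
          · exact Cardinal.mk_range_le.trans_lt (Cardinal.mk_Iio_toType_ord_lt i)
          · exact lt_of_lt_of_le (Cardinal.lt_aleph0_iff_set_finite.2 (Set.toFinite _)) hinf) (by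
          rintro U (⟨j, rfl⟩ | rfl | rfl)
          · exact ⟨hWo _, hpW _⟩
          · exact ⟨isOpen_interior, mem_interior_iff_mem_nhds.2 (hBn _ (e i).2)⟩
          · exact ⟨isClosed_closure.isOpen_compl, hi⟩)
      exact ⟨y, hy, hyU _ (by simp), fun j h => hyU _ (Or.inl ⟨⟨j, h⟩, rfl⟩),
        hyU (closure {z | ∃ j, ∃ _ : j < i, x j = z})ᶜ (by simp)⟩
    have h2 : x i = hex.choose := by rw [hx i]; exact dif_pos hex
    rw [h2]
    exact hex.choose_spec
  have main : ∀ J : Set ι, (∀ i ∈ J, p ∉ closure {z | ∃ j, ∃ _ : j < i, x j = z}) →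
      p ∈ closure (Set.image x J) → ∃ D : Set X, DiscreteTopology D ∧ p ∈ closure (D \ {p}) := by
    intro J hJ hpJ
    refine ⟨Set.image x J, ?_, ?_⟩
    · rw [discreteTopology_subtype_iff']
      rintro _ ⟨i, hi, rfl⟩
      obtain ⟨g1, g2, g3, g4⟩ := good i (hJ i hi)
      obtain ⟨v1, v2, v3⟩ := hV _ g1
      refine ⟨V (x i) ∩ (closure {z | ∃ j, ∃ _ : j < i, x j = z})ᶜ,
        v1.inter isClosed_closure.isOpen_compl, ?_⟩
      ext z
      constructor
      · rintro ⟨⟨h1, h2⟩, j, hj, rfl⟩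
        rcases lt_trichotomy j i with h | rfl | h
        · exact (h2 (subset_closure ⟨j, h, rfl⟩)).elim
        · rfl
        · exact (Set.disjoint_left.1 v3 h1 ((good j (hJ j hj)).2.2.1 i h)).elim
      · rintro rfl
        exact ⟨⟨v2, g4⟩, i, hi, rfl⟩
    · rwa [Set.sdiff_singleton_eq_self]
      rintro ⟨i, hi, h⟩
      exact (good i (hJ i hi)).1 h
  by_cases hall : ∀ i, p ∉ closure {z | ∃ j, ∃ _ : j < i, x j = z}
  · refine main Set.univ (fun i _ => hall i) ?_
    rw [mem_closure_iff_nhds]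
    intro N hN
    obtain ⟨U, hU, hUN⟩ := hBb N hN
    refine ⟨x (e.symm ⟨U, hU⟩), hUN ?_, _, trivial, rfl⟩
    have := interior_subset (good (e.symm ⟨U, hU⟩) (hall _)).2.1
    simpa using this
  · push Not at hall
    obtain ⟨i, hi, hmin⟩ := (wellFounded_lt (α := ι)).has_min
      {i | p ∈ closure {z | ∃ j, ∃ _ : j < i, x j = z}} hall
    refine main (Set.Iio i) (fun j hj h => hmin j h hj) ?_
    have hset : Set.image x (Set.Iio i) = {z | ∃ j, ∃ _ : j < i, x j = z} := by
      ext z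
      simp
    rw [hset]
    exact hi
end

section
/- If x is a discretely untouchable non-isolated point of a regular Hausdorff countably compact space X, then ω < ψ(x,X) < χ(x,X); in particular χ(x,X) ≥ ω₂. -/
open Cardinal

/-- A space is countably compact if every countable open cover has a finite subcover. -/
def CountablyCompactSpace' (X : Type u) [TopologicalSpace X] : Prop :=
  ∀ U : Set (Set X), U.Countable → (∀ u ∈ U, IsOpen u) → ⋃₀ U = Set.univ →
    ∃ F ⊆ U, F.Finite ∧ ⋃₀ F = Set.univ

theorem aux_char_mem {X : Type u} [TopologicalSpace X] (p : X) :
    ∃ B : Set (Set X), character p = #B ∧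
    (∀ U ∈ B, U ∈ nhds p) ∧ ∀ V ∈ nhds p, ∃ U ∈ B, U ⊆ V := by
  have h := csInf_mem (s := {c : Cardinal.{u} | ∃ B : Set (Set X), c = #B ∧
    (∀ U ∈ B, U ∈ nhds p) ∧ ∀ V ∈ nhds p, ∃ U ∈ B, U ⊆ V})
    ⟨_, {U | U ∈ nhds p}, rfl, fun U h => h, fun V hV => ⟨V, hV, subset_rfl⟩⟩
  exact h

theorem aux_char_le {X : Type u} [TopologicalSpace X] (p : X) (B : Set (Set X))
    (h1 : ∀ U ∈ B, U ∈ nhds p) (h2 : ∀ V ∈ nhds p, ∃ U ∈ B, U ⊆ V) : character p ≤ #B :=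
  csInf_le' ⟨B, rfl, h1, h2⟩

theorem aux_psi_le {X : Type u} [TopologicalSpace X] (p : X) (B : Set (Set X))
    (h1 : ∀ U ∈ B, IsOpen U) (h2 : ⋂₀ B = {p}) : pseudoCharacter p ≤ #B :=
  csInf_le' ⟨B, rfl, h1, h2⟩

theorem aux_psi_le_char {X : Type u} [TopologicalSpace X] [T1Space X] (p : X) :
    pseudoCharacter p ≤ character p := by
  obtain ⟨B, hB, h1, h2⟩ := aux_char_mem p
  rw [hB]
  refine (aux_psi_le p (interior '' B) ?_ ?_).trans mk_image_le
  · rintro _ ⟨U, -, rfl⟩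
    exact isOpen_interior
  · ext z
    simp only [Set.mem_sInter, Set.mem_singleton_iff]
    constructor
    · intro h
      by_contra hz
      obtain ⟨U, hU, hUV⟩ := h2 {z}ᶜ (isOpen_compl_singleton.mem_nhds (fun h => hz h.symm))
      exact hUV (interior_subset (h _ ⟨U, hU, rfl⟩)) rfl
    · rintro rfl _ ⟨U, hU, rfl⟩
      exact mem_interior_iff_mem_nhds.2 (h1 U hU)

theorem aux_psi_mem {X : Type u} [TopologicalSpace X] [T1Space X] (p : X) :
    ∃ B : Set (Set X), pseudoCharacter p = #B ∧ (∀ U ∈ B, IsOpen U) ∧ ⋂₀ B = {p} := by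
  have h := csInf_mem (s := {c : Cardinal.{u} | ∃ B : Set (Set X), c = #B ∧
    (∀ U ∈ B, IsOpen U) ∧ ⋂₀ B = {p}}) ?_
  · exact h
  · refine ⟨_, {U | IsOpen U ∧ p ∈ U}, rfl, fun U h => h.1, ?_⟩
    ext z
    simp only [Set.mem_sInter, Set.mem_singleton_iff]
    constructor
    · intro h
      by_contra hz
      exact h {z}ᶜ ⟨isOpen_compl_singleton, fun h => hz h.symm⟩ rfl
    · rintro rfl U hU
      exact hU.2

theorem aux_char_countable {X : Type u} [TopologicalSpace X] [T2Space X] [RegularSpace X]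
    (hcc : CountablyCompactSpace' X) (x : X) (h : pseudoCharacter x ≤ ℵ₀) :
    character x ≤ ℵ₀ := by
  obtain ⟨B, hB, h1, h2⟩ := aux_psi_mem x
  rw [hB, mk_le_aleph0_iff, Set.countable_coe_iff] at h
  have hxB : ∀ U ∈ B, x ∈ U := by
    have : x ∈ ⋂₀ B := by rw [h2]; rfl
    exact this
  have hK : ∀ U : Set X, ∃ K : Set X, U ∈ B → K ∈ nhds x ∧ IsClosed K ∧ K ⊆ U := by
    intro U
    by_cases hU : U ∈ B
    · obtain ⟨K, a, b, c⟩ := exists_mem_nhds_isClosed_subset ((h1 U hU).mem_nhds (hxB U hU))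
      exact ⟨K, fun _ => ⟨a, b, c⟩⟩
    · exact ⟨∅, fun h => absurd h hU⟩
  choose K hK using hK
  have hC : (K '' B).Countable := h.image K
  have hS := Set.countable_ofPred_finite_subset hC
  refine (aux_char_le x (Set.sInter '' {t | t.Finite ∧ t ⊆ K '' B}) ?_ ?_).trans ?_
  · rintro _ ⟨t, ⟨ht, hts⟩, rfl⟩
    refine (Filter.sInter_mem ht).2 fun U hU => ?_
    obtain ⟨V, hV, rfl⟩ := hts hU
    exact (hK V hV).1
  · intro V hV
    have hc1 : ∀ u ∈ (insert (interior V) (compl '' (K '' B))), IsOpen u := by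
      rintro u (rfl | ⟨_, ⟨U, hU, rfl⟩, rfl⟩)
      · exact isOpen_interior
      · exact (hK U hU).2.1.isOpen_compl
    have hc2 : ⋃₀ (insert (interior V) (compl '' (K '' B))) = Set.univ := by
      refine Set.eq_univ_of_forall fun z => ?_
      by_cases hz : z = x
      · subst hz
        exact ⟨_, Or.inl rfl, mem_interior_iff_mem_nhds.2 hV⟩
      · have : z ∉ ⋂₀ B := by rw [h2]; exact hz
        simp only [Set.mem_sInter, not_forall] at this
        obtain ⟨U, hU, hzU⟩ := this
        exact ⟨_, Or.inr ⟨_, ⟨U, hU, rfl⟩, rfl⟩, fun h => hzU ((hK U hU).2.2 h)⟩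
    obtain ⟨F, hFU, hF, hFc⟩ := hcc (insert (interior V) (compl '' (K '' B)))
      ((hC.image _).insert _) hc1 hc2
    · refine ⟨_, ⟨{c | c ∈ K '' B ∧ cᶜ ∈ F}, ⟨?_, fun c hc => hc.1⟩, rfl⟩, ?_⟩
      · exact (hF.preimage (compl_injective.injOn)).subset fun c hc => hc.2
      · intro z hz
        have : z ∈ ⋃₀ F := by rw [hFc]; trivial
        obtain ⟨u, hu, hzu⟩ := this
        rcases hFU hu with rfl | ⟨c, hc, rfl⟩
        · exact interior_subset hzu
        · exact absurd (hz c ⟨hc, hu⟩) hzu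
  · rw [mk_le_aleph0_iff, Set.countable_coe_iff]
    exact hS.image _

theorem aux_psi_infinite {X : Type u} [TopologicalSpace X] [T1Space X] (x : X)
    (hx : ¬ IsOpen ({x} : Set X)) : ℵ₀ ≤ pseudoCharacter x := by
  by_contra hlt
  obtain ⟨B, hB, h1, h2⟩ := aux_psi_mem x
  rw [not_le, hB, lt_aleph0_iff_set_finite] at hlt
  apply hx
  rw [← h2]
  exact hlt.isOpen_sInter h1

theorem aux_discrete {X : Type u} [TopologicalSpace X] {ι : Type u} [LinearOrder ι]
    (x : X) (O W : X → Set X)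
    (hOo : ∀ z, z ≠ x → IsOpen (O z) ∧ z ∈ O z ∧ Disjoint (O z) (W z))
    (y : ι → X) (S : Set ι)
    (hy : ∀ a ∈ S, y a ≠ x ∧ (∀ b < a, y a ∈ W (y b)) ∧ y a ∉ closure (y '' Set.Iio a)) :
    DiscreteTopology (y '' S) := by
  rw [discreteTopology_subtype_iff']
  rintro _ ⟨a, ha, rfl⟩
  obtain ⟨h1, h2, h3⟩ := hy a ha
  obtain ⟨o1, o2, o3⟩ := hOo _ h1
  refine ⟨O (y a) ∩ (closure (y '' Set.Iio a))ᶜ, o1.inter isClosed_closure.isOpen_compl, ?_⟩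
  ext z
  simp only [Set.mem_inter_iff, Set.mem_singleton_iff]
  constructor
  · rintro ⟨⟨hz1, hz2⟩, b, hb, rfl⟩
    rcases lt_trichotomy b a with hba | rfl | hab
    · exact (hz2 (subset_closure (Set.mem_image_of_mem y (Set.mem_Iio.2 hba)))).elim
    · rfl
    · exact absurd ((hy b hb).2.1 a hab) (Set.disjoint_left.1 o3 hz1)
  · rintro rfl
    exact ⟨⟨o2, h3⟩, a, ha, rfl⟩

theorem aux_ne {X : Type u} [TopologicalSpace X] [T2Space X] (x : X)
    (hx : ¬ IsOpen ({x} : Set X))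
    (hunt : ¬ ∃ D : Set X, DiscreteTopology D ∧ x ∈ closure (D \ {x})) :
    pseudoCharacter x ≠ character x := by
  intro heq
  have hinf := aux_psi_infinite x hx
  obtain ⟨B, hB, hB1, hB2⟩ := aux_char_mem x
  rw [← heq] at hB
  obtain ⟨e⟩ : Nonempty ((#B).ord.ToType ≃ B) := Cardinal.eq.1 (by simp)
  have hwf : WellFounded (fun a b : (#B).ord.ToType => a < b) := wellFounded_lt
  have hcard : ∀ a : (#B).ord.ToType, #(Set.Iio a) < pseudoCharacter x := by
    intro a
    rw [hB]
    have := Cardinal.mk_Iio_lt a (by simp)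
    simpa using this
  have hsep : ∀ z, ∃ P : Set X × Set X, z ≠ x →
      IsOpen P.1 ∧ IsOpen P.2 ∧ z ∈ P.1 ∧ x ∈ P.2 ∧ Disjoint P.1 P.2 := by
    intro z
    by_cases hz : z = x
    · exact ⟨(∅, ∅), fun h => absurd hz h⟩
    · obtain ⟨u, v, h⟩ := t2_separation hz
      exact ⟨(u, v), fun _ => h⟩
  choose P hP using hsep
  let Q : (a : (#B).ord.ToType) → ((b : (#B).ord.ToType) → b < a → X) → X → Prop := fun a f z =>
    z ≠ x ∧ z ∈ interior (e a).1 ∧ (∀ b, ∀ h : b < a, z ∈ (P (f b h)).2) ∧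
      (∀ b < a, z ∈ interior (e b).1) ∧ z ∉ closure {w | ∃ b, ∃ h : b < a, w = f b h}
  classical
  let y : (#B).ord.ToType → X := hwf.fix fun a f => if h : ∃ z, Q a f z then h.choose else x
  have hyeq : ∀ a, y a = if h : ∃ z, Q a (fun b _ => y b) z then h.choose else x := by
    intro a
    exact hwf.fix_eq _ a
  have himg : ∀ a : (#B).ord.ToType, {w | ∃ b, ∃ _ : b < a, w = y b} = y '' Set.Iio a := by
    intro a
    ext w
    constructor
    · rintro ⟨b, hb, rfl⟩
      exact ⟨b, hb, rfl⟩
    · rintro ⟨b, hb, rfl⟩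
      exact ⟨b, hb, rfl⟩
  have hOo : ∀ z, z ≠ x → IsOpen (P z).1 ∧ z ∈ (P z).1 ∧ Disjoint (P z).1 (P z).2 :=
    fun z hz => ⟨(hP z hz).1, (hP z hz).2.2.1, (hP z hz).2.2.2.2⟩
  have key : ∀ S : Set (#B).ord.ToType, (∀ a ∈ S, Q a (fun b _ => y b) (y a)) → x ∉ closure (y '' S) := by
    intro S hS hcl
    refine hunt ⟨y '' S, aux_discrete x (fun z => (P z).1) (fun z => (P z).2) hOo y S ?_, ?_⟩
    · intro a ha
      obtain ⟨q1, q2, q3, q4, q5⟩ := hS a ha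
      rw [himg] at q5
      exact ⟨q1, q3, q5⟩
    · rwa [Set.sdiff_singleton_eq_self]
      rintro ⟨a, ha, hax⟩
      exact (hS a ha).1 hax
  have main : ∀ a, Q a (fun b _ => y b) (y a) := by
    intro a
    induction a using hwf.induction with
    | _ a ih =>
    have hex : ∃ z, Q a (fun b _ => y b) z := by
      have hncl := key (Set.Iio a) ih
      let F : Set (Set X) := insert (interior (e a).1 ∩ (closure (y '' Set.Iio a))ᶜ)
        ((fun b : (#B).ord.ToType => interior (e b).1 ∩ (P (y b)).2) '' Set.Iio a)
      have hFo : ∀ U ∈ F, IsOpen U := by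
        rintro U (rfl | ⟨b, hb, rfl⟩)
        · exact isOpen_interior.inter isClosed_closure.isOpen_compl
        · exact isOpen_interior.inter (hP _ (ih b hb).1).2.1
      have hFx : x ∈ ⋂₀ F := by
        rintro U (rfl | ⟨b, hb, rfl⟩)
        · exact ⟨mem_interior_iff_mem_nhds.2 (hB1 _ (e a).2), hncl⟩
        · exact ⟨mem_interior_iff_mem_nhds.2 (hB1 _ (e b).2), (hP _ (ih b hb).1).2.2.2.1⟩
      have hFc : #F < pseudoCharacter x := by
        refine (mk_insert_le).trans_lt (add_lt_of_lt hinf (mk_image_le.trans_lt (hcard a)) ?_)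
        exact one_lt_aleph0.trans_le hinf
      have hFne : ⋂₀ F ≠ {x} := fun h => absurd (aux_psi_le x F hFo h) (not_le.2 hFc)
      have : ∃ z ∈ ⋂₀ F, z ≠ x := by
        by_contra hcon
        push Not at hcon
        exact hFne (Set.eq_singleton_iff_unique_mem.2 ⟨hFx, hcon⟩)
      obtain ⟨z, hz, hzx⟩ := this
      have hza := hz _ (Or.inl rfl)
      refine ⟨z, hzx, hza.1, fun b hb => (hz _ (Or.inr ⟨b, hb, rfl⟩)).2,
        fun b hb => (hz _ (Or.inr ⟨b, hb, rfl⟩)).1, ?_⟩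
      rw [himg]
      exact hza.2
    rw [hyeq a, dif_pos hex]
    exact hex.choose_spec
  refine key Set.univ (fun a _ => main a) ?_
  rw [mem_closure_iff_nhds]
  intro V hV
  obtain ⟨U, hU, hUV⟩ := hB2 V hV
  have hm := (main (e.symm ⟨U, hU⟩)).2.1
  rw [e.apply_symm_apply] at hm
  exact ⟨y (e.symm ⟨U, hU⟩), hUV (interior_subset hm), _, trivial, rfl⟩

/-- If `x` is a discretely untouchable non-isolated point of a regular Hausdorff
countably compact space `X`, then `ω < ψ(x,X) < χ(x,X)`; in particular `χ(x,X) ≥ ω₂`. -/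
theorem stmt7 {X : Type u} [TopologicalSpace X] [T2Space X] [RegularSpace X]
    (hcc : CountablyCompactSpace' X) (x : X) (hx : ¬ IsOpen ({x} : Set X))
    (hunt : ¬ ∃ D : Set X, DiscreteTopology D ∧ x ∈ closure (D \ {x})) :
    Cardinal.aleph0 < pseudoCharacter x ∧ pseudoCharacter x < character x ∧
      Cardinal.aleph 2 ≤ character x := by
  have h1 : Cardinal.aleph0 < pseudoCharacter x := by
    refine lt_of_le_of_ne (aux_psi_infinite x hx) fun h => ?_
    have h2 := aux_char_countable hcc x h.symm.le
    exact aux_ne x hx hunt (le_antisymm (aux_psi_le_char x) (h2.trans h.le))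
  have h2 := lt_of_le_of_ne (aux_psi_le_char x) (aux_ne x hx hunt)
  refine ⟨h1, h2, ?_⟩
  have h3 : Cardinal.aleph 1 ≤ pseudoCharacter x := by
    rw [← succ_aleph0]
    exact Order.succ_le_of_lt h1
  have h4 : Cardinal.aleph 2 = Order.succ (Cardinal.aleph 1) := by
    rw [succ_aleph, one_add_one_eq_two]
  rw [h4]
  exact Order.succ_le_of_lt (h3.trans_lt h2)
end

section
/- If x is a discretely untouchable non-isolated point of a regular Hausdorff initially κ-compact space X (κ an infinite cardinal), then κ < ψ(x,X) < χ(x,X); in particular χ(x,X) ≥ κ⁺⁺. -/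
open Cardinal

/-- A space is initially `κ`-compact if every open cover of cardinality at most `κ`
has a finite subcover. -/
def InitiallyCompact (X : Type u) [TopologicalSpace X] (κ : Cardinal.{u}) : Prop :=
  ∀ U : Set (Set X), #U ≤ κ → (∀ u ∈ U, IsOpen u) → ⋃₀ U = Set.univ →
    ∃ F ⊆ U, F.Finite ∧ ⋃₀ F = Set.univ

theorem psi_inter_ne {X : Type u} [TopologicalSpace X] (x : X) (B : Set (Set X))
    (hB : ∀ U ∈ B, IsOpen U ∧ x ∈ U) (hc : #B < pseudoCharacter x) : ∃ y ∈ ⋂₀ B, y ≠ x := by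
  by_contra hcon
  push Not at hcon
  have : ⋂₀ B = {x} := by
    apply Set.eq_singleton_iff_unique_mem.2
    exact ⟨fun U hU => (hB U hU).2, hcon⟩
  exact absurd (csInf_le' ⟨B, rfl, fun U hU => (hB U hU).1, this⟩ : pseudoCharacter x ≤ #B)
    (not_le.2 hc)

theorem exists_char {X : Type u} [TopologicalSpace X] (x : X) :
    ∃ B : Set (Set X), character x = #B ∧
      (∀ U ∈ B, U ∈ nhds x) ∧ ∀ V ∈ nhds x, ∃ U ∈ B, U ⊆ V :=
  csInf_mem (s := {c : Cardinal.{u} | ∃ B : Set (Set X), c = #B ∧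
    (∀ U ∈ B, U ∈ nhds x) ∧ ∀ V ∈ nhds x, ∃ U ∈ B, U ⊆ V})
    ⟨_, {U | U ∈ nhds x}, rfl, fun _ h => h, fun V hV => ⟨V, hV, subset_rfl⟩⟩

theorem psi_le_char {X : Type u} [TopologicalSpace X] [T2Space X] (x : X) :
    pseudoCharacter x ≤ character x := by
  obtain ⟨B, hc, hB, hB2⟩ := exists_char x
  rw [hc]
  refine le_trans (csInf_le' ⟨interior '' B, rfl, ?_, ?_⟩) mk_image_le
  · rintro _ ⟨U, _, rfl⟩
    exact isOpen_interior
  · apply Set.eq_singleton_iff_unique_mem.2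
    constructor
    · rintro _ ⟨U, hU, rfl⟩
      exact mem_interior_iff_mem_nhds.2 (hB U hU)
    · intro y hy
      by_contra hne
      obtain ⟨U, hU, hUV⟩ := hB2 {y}ᶜ (isOpen_compl_singleton.mem_nhds (fun h => hne h.symm))
      exact hUV (interior_subset (hy _ ⟨U, hU, rfl⟩)) rfl

theorem exists_psi {X : Type u} [TopologicalSpace X] [T2Space X] (x : X) :
    ∃ B : Set (Set X), pseudoCharacter x = #B ∧ (∀ U ∈ B, IsOpen U) ∧ ⋂₀ B = {x} := by
  refine csInf_mem (s := {c : Cardinal.{u} | ∃ B : Set (Set X), c = #B ∧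
    (∀ U ∈ B, IsOpen U) ∧ ⋂₀ B = {x}}) ⟨_, {U | IsOpen U ∧ x ∈ U}, rfl, fun _ h => h.1, ?_⟩
  apply Set.eq_singleton_iff_unique_mem.2
  refine ⟨fun U hU => hU.2, fun y hy => ?_⟩
  by_contra hne
  exact hy {y}ᶜ ⟨isOpen_compl_singleton, fun h => hne h.symm⟩ rfl

theorem psi_infinite {X : Type u} [TopologicalSpace X] [T2Space X] (x : X)
    (hx : ¬ IsOpen ({x} : Set X)) : ℵ₀ ≤ pseudoCharacter x := by
  obtain ⟨B, hc, hB, hB2⟩ := exists_psi x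
  by_contra hlt
  rw [hc, not_le, lt_aleph0_iff_set_finite] at hlt
  exact hx (hB2 ▸ hlt.isOpen_sInter hB)

theorem char_le_psi {X : Type u} [TopologicalSpace X] [T2Space X] [RegularSpace X]
    (κ : Cardinal.{u}) (hκ : Cardinal.aleph0 ≤ κ) (hic : InitiallyCompact X κ)
    (x : X) (hx : ¬ IsOpen ({x} : Set X)) (h : pseudoCharacter x ≤ κ) :
    character x ≤ pseudoCharacter x := by
  classical
  have hinf := psi_infinite x hx
  obtain ⟨B, hc, hB, hB2⟩ := exists_psi x
  rw [hc] at h hinf ⊢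
  have hxB : ∀ U ∈ B, x ∈ U := by
    have : x ∈ ⋂₀ B := by rw [hB2]; rfl
    exact this
  have : ∀ U : B, ∃ C ∈ nhds x, IsClosed C ∧ C ⊆ (U : Set X) := fun U =>
    exists_mem_nhds_isClosed_subset ((hB U U.2).mem_nhds (hxB U U.2))
  choose C hCn hCc hCs using this
  have : Infinite B := infinite_iff.2 hinf
  have hcard : #(Set.range fun F : Finset B => ⋂ U ∈ F, C U) ≤ #B :=
    mk_range_le.trans (mk_finset_of_infinite B).le
  refine le_trans (csInf_le' ⟨_, rfl, ?_, ?_⟩) hcard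
  · rintro _ ⟨F, rfl⟩
    exact (Filter.biInter_finset_mem F).2 fun U _ => hCn U
  · intro V hV
    have hcov : #(insert (interior V) (Set.range fun U : B => (C U)ᶜ) : Set (Set X)) ≤ κ ∧
        (∀ u ∈ insert (interior V) (Set.range fun U : B => (C U)ᶜ), IsOpen u) ∧
        ⋃₀ (insert (interior V) (Set.range fun U : B => (C U)ᶜ)) = Set.univ := by
      refine ⟨?_, ?_, ?_⟩
      · refine mk_insert_le.trans (add_le_of_le hκ (mk_range_le.trans h) (one_le_aleph0.trans hκ))
      · rintro u (rfl | ⟨U, rfl⟩)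
        · exact isOpen_interior
        · exact (hCc U).isOpen_compl
      · apply Set.eq_univ_of_forall
        intro y
        by_cases hy : y = x
        · exact ⟨_, Set.mem_insert _ _, hy ▸ mem_interior_iff_mem_nhds.2 hV⟩
        · have : y ∉ ⋂₀ B := by rw [hB2]; exact hy
          simp only [Set.mem_sInter, not_forall] at this
          obtain ⟨U, hU, hyU⟩ := this
          exact ⟨_, Set.mem_insert_of_mem _ ⟨⟨U, hU⟩, rfl⟩, fun hh => hyU (hCs ⟨U, hU⟩ hh)⟩
    obtain ⟨G, hGF, hGfin, hG⟩ := hic _ hcov.1 hcov.2.1 hcov.2.2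
    have hsub : G \ {interior V} ⊆ (fun U : B => (C U)ᶜ) '' Set.univ := by
      rintro g ⟨hg, hgne⟩
      rcases hGF hg with h1 | ⟨U, rfl⟩
      · exact absurd h1 hgne
      · exact ⟨U, trivial, rfl⟩
    obtain ⟨F, -, hF⟩ := Set.exists_subset_image_finite_and.1
      ⟨G \ {interior V}, hsub, hGfin.subset Set.sdiff_subset, rfl⟩
    refine ⟨_, ⟨hF.1.toFinset, rfl⟩, ?_⟩
    intro y hy
    simp only [Set.mem_iInter, Set.Finite.mem_toFinset] at hy
    have hyG : y ∈ ⋃₀ G := by rw [hG]; trivial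
    obtain ⟨g, hg, hyg⟩ := hyG
    by_cases hgV : g = interior V
    · exact interior_subset (hgV ▸ hyg)
    · have : g ∈ (fun U : B => (C U)ᶜ) '' F := by rw [← hF.2]; exact ⟨hg, hgV⟩
      obtain ⟨U, hU, rfl⟩ := this
      exact absurd (hy U hU) hyg

theorem psi_ne_char {X : Type u} [TopologicalSpace X] [T2Space X] [RegularSpace X]
    (x : X) (hx : ¬ IsOpen ({x} : Set X))
    (hunt : ¬ ∃ D : Set X, DiscreteTopology D ∧ x ∈ closure (D \ {x})) :
    pseudoCharacter x ≠ character x := by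
  classical
  intro heq
  have hinf := psi_infinite x hx
  obtain ⟨B, hc, hB, hB2⟩ := exists_char x
  obtain ⟨r, wo, hr⟩ := exists_ord_eq B
  have hW : ∀ y : X, ∃ W : Set X, y ≠ x → IsOpen W ∧ x ∈ W ∧ y ∉ closure W := by
    intro y
    by_cases hy : y = x
    · exact ⟨∅, fun h => absurd hy h⟩
    · obtain ⟨C, hC, hCc, hCs⟩ := exists_mem_nhds_isClosed_subset
        (isOpen_compl_singleton.mem_nhds (fun h => hy h.symm : x ∈ ({y}ᶜ : Set X)))
      refine ⟨interior C, fun _ => ⟨isOpen_interior, mem_interior_iff_mem_nhds.2 hC, fun h => ?_⟩⟩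
      exact hCs (closure_minimal interior_subset hCc h) rfl
  choose W hW using hW
  let P : ∀ a : B, (∀ b : B, r b a → X) → X → Prop := fun a f y =>
    y ≠ x ∧ y ∈ (a : Set X) ∧ (∀ b h, y ∈ W (f b h)) ∧ y ∉ closure {z | ∃ b h, z = f b h}
  let g : ∀ a : B, (∀ b : B, r b a → X) → X := fun a f =>
    if h : ∃ y, P a f y then h.choose else x
  have hwf : WellFounded r := wo.wf
  let f : B → X := hwf.fix g
  have hf : ∀ a, (∃ y, P a (fun b _ => f b) y) → P a (fun b _ => f b) (f a) := by
    intro a h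
    have h1 : f a = h.choose := by
      change hwf.fix g a = _
      rw [hwf.fix_eq]
      exact dif_pos h
    rw [h1]
    exact h.choose_spec
  have hdisc : ∀ S : Set B, (∀ a ∈ S, P a (fun b _ => f b) (f a)) → x ∉ closure (f '' S) := by
    intro S hS hcl
    apply hunt
    refine ⟨f '' S, ?_, ?_⟩
    · rw [discreteTopology_iff_isOpen_singleton]
      rintro ⟨_, a, ha, rfl⟩
      obtain ⟨h1, h2, h3, h4⟩ := hS a ha
      refine isOpen_induced_iff.2 ⟨(closure (W (f a)))ᶜ ∩ (closure {z | ∃ b, ∃ h : r b a, z = f b})ᶜ,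
        isClosed_closure.isOpen_compl.inter isClosed_closure.isOpen_compl, ?_⟩
      apply Set.eq_singleton_iff_unique_mem.2
      refine ⟨⟨(hW _ h1).2.2, h4⟩, ?_⟩
      rintro ⟨_, c, hcS, rfl⟩ ⟨hc1, hc2⟩
      rcases trichotomous_of r c a with h | h | h
      · exact (hc2 (subset_closure (show f c ∈ {z | ∃ b, ∃ h : r b a, z = f b} from ⟨c, h, rfl⟩))).elim
      · subst h; rfl
      · exact absurd (subset_closure ((hS c hcS).2.2.1 a h)) hc1
    · rwa [Set.sdiff_singleton_eq_self]
      rintro ⟨a, ha, hax⟩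
      exact (hS a ha).1 hax
  have hP : ∀ a, P a (fun b _ => f b) (f a) := by
    intro a
    induction a using hwf.induction with
    | _ a ih =>
      apply hf
      have hncl := hdisc {b | r b a} ih
      have hset : {z | ∃ b, ∃ h : r b a, z = f b} = f '' {b | r b a} := by
        ext z
        constructor
        · rintro ⟨b, h, rfl⟩; exact ⟨b, h, rfl⟩
        · rintro ⟨b, h, rfl⟩; exact ⟨b, h, rfl⟩
      have hcard : #{b | r b a} < #B := card_typein_lt a hr
      have hcard' : #{b | r b a} < pseudoCharacter x := by rwa [heq, hc]
      obtain ⟨y, hy, hyx⟩ := psi_inter_ne x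
        (insert (interior (a : Set X)) (insert (closure (f '' {b | r b a}))ᶜ
          ((fun b => W (f b)) '' {b | r b a}))) (by
          rintro U (rfl | rfl | ⟨b, hb, rfl⟩)
          · exact ⟨isOpen_interior, mem_interior_iff_mem_nhds.2 (hB a a.2)⟩
          · exact ⟨isClosed_closure.isOpen_compl, hncl⟩
          · exact ⟨(hW _ (ih b hb).1).1, (hW _ (ih b hb).1).2.1⟩) (by
          have h1 := one_lt_aleph0.trans_le hinf
          exact mk_insert_le.trans_lt (add_lt_of_lt hinf (mk_insert_le.trans_lt
            (add_lt_of_lt hinf (mk_image_le.trans_lt hcard') h1)) h1))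
      refine ⟨y, hyx, interior_subset (hy _ (Or.inl rfl)), ?_, ?_⟩
      · intro b hb
        exact hy _ (Or.inr (Or.inr ⟨b, hb, rfl⟩))
      · rw [hset]
        exact hy _ (Or.inr (Or.inl rfl))
  apply hdisc Set.univ fun a _ => hP a
  rw [mem_closure_iff_nhds]
  intro V hV
  obtain ⟨U, hU, hUV⟩ := hB2 V hV
  exact ⟨f ⟨U, hU⟩, hUV (hP ⟨U, hU⟩).2.1, ⟨U, hU⟩, trivial, rfl⟩

/-- If `x` is a discretely untouchable non-isolated point of a regular Hausdorff
initially `κ`-compact space, then `κ < ψ(x,X) < χ(x,X)`; in particular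
`χ(x,X) ≥ κ⁺⁺`. -/
theorem stmt9 {X : Type u} [TopologicalSpace X] [T2Space X] [RegularSpace X]
    (κ : Cardinal.{u}) (hκ : Cardinal.aleph0 ≤ κ) (hic : InitiallyCompact X κ)
    (x : X) (hx : ¬ IsOpen ({x} : Set X))
    (hunt : ¬ ∃ D : Set X, DiscreteTopology D ∧ x ∈ closure (D \ {x})) :
    κ < pseudoCharacter x ∧ pseudoCharacter x < character x ∧
      Order.succ (Order.succ κ) ≤ character x := by
  have h1 : pseudoCharacter x < character x :=
    lt_of_le_of_ne (psi_le_char x) (psi_ne_char x hx hunt)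
  have h2 : κ < pseudoCharacter x := by
    by_contra h
    exact absurd (char_le_psi κ hκ hic x hx (not_lt.1 h)) (not_le.2 h1)
  exact ⟨h2, h1, Order.succ_le_of_lt ((Order.succ_le_of_lt h2).trans_lt h1)⟩
end

section
/- For every infinite cardinal κ, the κ-closure cl_κ(A) of any subset A of a compact Hausdorff space X is a κ-bounded subspace of X: the closure in cl_κ(A) of every subset of cl_κ(A) of cardinality at most κ is compact. -/
open Cardinal

/-- The `κ`-closure of a set `A`: the union of the closures of all subsets of `A`
of cardinality at most `κ`. -/
def kClosure {X : Type u} [TopologicalSpace X] (κ : Cardinal.{u}) (A : Set X) : Set X :=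
  ⋃ B ∈ {B : Set X | B ⊆ A ∧ #B ≤ κ}, closure B

/-- For every infinite cardinal `κ`, the `κ`-closure of any subset of a compact
Hausdorff space is a `κ`-bounded subspace: the closure (in the subspace) of each
of its subsets of cardinality at most `κ` is compact. -/
theorem stmt15 {X : Type u} [TopologicalSpace X] [CompactSpace X] [T2Space X]
    (κ : Cardinal.{u}) (hκ : Cardinal.aleph0 ≤ κ) (A : Set X) :
    ∀ B : Set (kClosure κ A), #B ≤ κ → IsCompact (closure B) := by
  intro B hB
  have key : ∀ b : kClosure κ A, ∃ C : Set X, C ⊆ A ∧ #C ≤ κ ∧ (b : X) ∈ closure C := by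
    intro b
    have hb := b.2
    simp only [kClosure, Set.mem_iUnion, Set.mem_setOf_eq] at hb
    obtain ⟨C, ⟨h1, h2⟩, h3⟩ := hb
    exact ⟨C, h1, h2, h3⟩
  choose C hCA hCκ hbC using key
  let D : Set X := ⋃ b : B, C b.1
  have hDA : D ⊆ A := Set.iUnion_subset fun b => hCA b.1
  have hDκ : #D ≤ κ := by
    refine (Cardinal.mk_iUnion_le _).trans ?_
    calc #B * ⨆ b : B, #(C b.1) ≤ κ * κ := mul_le_mul' hB (ciSup_le' fun b => hCκ b.1)
      _ = κ := Cardinal.mul_eq_self hκ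
  have hDcl : closure D ⊆ kClosure κ A := by
    intro x hx
    simp only [kClosure, Set.mem_iUnion, Set.mem_setOf_eq]
    exact ⟨D, ⟨hDA, hDκ⟩, hx⟩
  have hBD : closure (Subtype.val '' B) ⊆ closure D := by
    refine closure_minimal ?_ isClosed_closure
    rintro _ ⟨b, hb, rfl⟩
    exact closure_mono (Set.subset_iUnion (fun b : B => C b.1) ⟨b, hb⟩) (hbC b)
  rw [Topology.IsInducing.subtypeVal.closure_eq_preimage_closure_image,
    Topology.IsInducing.subtypeVal.isCompact_iff, Set.image_preimage_eq_of_subset]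
  · exact isClosed_closure.isCompact
  · rw [Subtype.range_coe]
    exact hBD.trans hDcl
end

section
/- Every irresolvable topological space X has a nonempty open subspace Y that is hereditarily irresolvable, i.e., no nonempty subspace of Y contains two disjoint dense (in that subspace) subsets. -/
/-- A space is irresolvable if it is nonempty and does not contain two disjoint
dense subsets. -/
def Irresolvable (X : Type u) [TopologicalSpace X] : Prop :=
  Nonempty X ∧ ¬ ∃ D₁ D₂ : Set X, Dense D₁ ∧ Dense D₂ ∧ Disjoint D₁ D₂

/-- Every irresolvable space has a nonempty open subspace `Y` that is hereditarily
irresolvable: every nonempty subspace of `Y` is irresolvable. -/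
theorem stmt19 {X : Type u} [TopologicalSpace X] (hX : Irresolvable X) :
    ∃ Y : Set X, IsOpen Y ∧ Y.Nonempty ∧
      ∀ S : Set X, S ⊆ Y → S.Nonempty → Irresolvable S := by
  obtain ⟨_, hX⟩ := hX
  let G : Set (Set X × Set X) :=
    {p | Disjoint p.1 p.2 ∧ p.1 ⊆ closure p.2 ∧ p.2 ⊆ closure p.1}
  obtain ⟨⟨A, B⟩, hm⟩ : ∃ m, Maximal (· ∈ G) m := by
    apply zorn_le₀ G
    intro c hc hchain
    refine ⟨(⋃ p ∈ c, p.1, ⋃ p ∈ c, p.2), ⟨?_, ?_, ?_⟩, ?_⟩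
    · rw [Set.disjoint_left]
      intro x hx hx'
      simp only [Set.mem_iUnion] at hx hx'
      obtain ⟨p, hp, hxp⟩ := hx
      obtain ⟨q, hq, hxq⟩ := hx'
      rcases hchain.total hp hq with h | h
      · exact Set.disjoint_left.1 (hc hq).1 (h.1 hxp) hxq
      · exact Set.disjoint_left.1 (hc hp).1 hxp (h.2 hxq)
    · exact Set.iUnion₂_subset fun p hp => (hc hp).2.1.trans
        (closure_mono (Set.subset_biUnion_of_mem (u := fun p : Set X × Set X => p.2) hp))
    · exact Set.iUnion₂_subset fun p hp => (hc hp).2.2.trans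
        (closure_mono (Set.subset_biUnion_of_mem (u := fun p : Set X × Set X => p.1) hp))
    · intro p hp
      exact ⟨Set.subset_biUnion_of_mem (u := fun p : Set X × Set X => p.1) hp,
        Set.subset_biUnion_of_mem (u := fun p : Set X × Set X => p.2) hp⟩
  obtain ⟨hd, hAB, hBA⟩ := hm.prop
  simp only at hd hAB hBA
  have hBA' : closure B ⊆ closure A := closure_minimal hBA isClosed_closure
  have hAB' : closure A ⊆ closure B := closure_minimal hAB isClosed_closure
  refine ⟨(closure A)ᶜ, isClosed_closure.isOpen_compl, ?_, ?_⟩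
  · rw [Set.nonempty_compl]
    intro h
    exact hX ⟨A, B, dense_iff_closure_eq.2 h,
      dense_iff_closure_eq.2 (Set.univ_subset_iff.1 (h ▸ hAB')), hd⟩
  · intro S hS hne
    have : Nonempty S := hne.to_subtype
    refine ⟨inferInstance, ?_⟩
    rintro ⟨D, E, hD, hE, hDE⟩
    have key : ∀ F : Set S, Dense F → S ⊆ closure (Subtype.val '' F) := by
      intro F hF x hx
      exact closure_subtype.1 (hF ⟨x, hx⟩)
    have sub : ∀ F : Set S, Subtype.val '' F ⊆ S := by
      rintro F _ ⟨x, _, rfl⟩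
      exact x.2
    have hG : ((A ∪ Subtype.val '' D, B ∪ Subtype.val '' E) : Set X × Set X) ∈ G := by
      refine ⟨?_, ?_, ?_⟩
      · simp only [Set.disjoint_union_left, Set.disjoint_union_right]
        refine ⟨⟨hd, ?_⟩, ?_, ?_⟩
        · exact Set.disjoint_left.2 fun x hx hx' => hS (sub D hx) (hBA hx')
        · exact Set.disjoint_left.2 fun x hx hx' => hS (sub E hx') (subset_closure hx)
        · exact (Set.disjoint_image_iff Subtype.val_injective).2 hDE
      · exact Set.union_subset (hAB.trans (closure_mono Set.subset_union_left))
          (((sub D).trans (key E hE)).trans (closure_mono Set.subset_union_right))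
      · exact Set.union_subset (hBA.trans (closure_mono Set.subset_union_left))
          (((sub E).trans (key D hD)).trans (closure_mono Set.subset_union_right))
    have hle := hm.le_of_ge hG ⟨Set.subset_union_left, Set.subset_union_left⟩
    obtain ⟨x, hx⟩ := hD.nonempty
    exact hS x.2 (subset_closure (hle.1 (Or.inr ⟨x, hx, rfl⟩)))
end
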